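/- Let W be a finite von Neumann algebra on a Hilbert space H with affiliated operator algebra U, and let u ∈ U. Set s = (1 + uu*)⁻¹ and a = (1 + uu*)⁻¹u. Then s and a are bounded operators lying in W, s is a non-zero-divisor in W, and u = s⁻¹a. -/

import Mathlib

open scoped InnerProductSpace

theorem aux_proj {H : Type*} [NormedAddCommGroup H] [InnerProductSpace ℂ H] [CompleteSpace H]
    (u : H →ₗ.[ℂ] H) (hclosed : u.IsClosed) :
    ∃ P Q : (H × H) →L[ℂ] H, ∀ z : H × H, ∃ hp : P z ∈ u.domain, u ⟨P z, hp⟩ = Q z ∧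
      ∀ w : u.domain, ⟪z.1 - P z, (w : H)⟫_ℂ + ⟪z.2 - Q z, u w⟫_ℂ = 0 := by
  let e := WithLp.prodContinuousLinearEquiv 2 ℂ H H
  let G : Submodule ℂ (WithLp 2 (H × H)) := u.graph.comap (e : WithLp 2 (H × H) →ₗ[ℂ] H × H)
  have hG : IsClosed (G : Set (WithLp 2 (H × H))) := by
    have : IsClosed (u.graph : Set (H × H)) := hclosed
    exact this.preimage e.continuous
  haveI : CompleteSpace G := hG.completeSpace_coe
  let R : (H × H) →L[ℂ] (H × H) :=
    (e : WithLp 2 (H × H) →L[ℂ] H × H) ∘L G.starProjection ∘L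
      (e.symm : H × H →L[ℂ] WithLp 2 (H × H))
  refine ⟨(ContinuousLinearMap.fst ℂ H H) ∘L R, (ContinuousLinearMap.snd ℂ H H) ∘L R, fun z => ?_⟩
  have hm : R z ∈ u.graph := G.starProjection_apply_mem (e.symm z)
  have ho := G.sub_starProjection_mem_orthogonal (e.symm z)
  obtain ⟨y, hy1, hy2⟩ := (LinearPMap.mem_graph_iff u).1 hm
  have hp : (R z).1 ∈ u.domain := hy1 ▸ y.2
  refine ⟨hp, ?_, fun w => ?_⟩
  · have : (⟨(R z).1, hp⟩ : u.domain) = y := Subtype.ext hy1.symm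
    change u ⟨(R z).1, hp⟩ = (R z).2
    rw [this, hy2]
  · have hw : e.symm ((w : H), u w) ∈ G := u.mem_graph w
    have := (Submodule.mem_orthogonal' _ _).1 ho _ hw
    rw [WithLp.prod_inner_apply] at this
    exact this

/-- An operator commuting with the unitaries of the commutant lies in the algebra. -/
theorem aux_mem {H : Type*} [NormedAddCommGroup H] [InnerProductSpace ℂ H] [CompleteSpace H]
    (W : VonNeumannAlgebra H) (s : H →L[ℂ] H)
    (h : ∀ T : H →L[ℂ] H, T ∈ unitary (H →L[ℂ] H) → (∀ w ∈ W, T * w = w * T) →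
      T * s = s * T) : s ∈ W := by
  rw [← W.commutant_commutant, VonNeumannAlgebra.mem_commutant_iff]
  intro g hg
  let A : StarSubalgebra ℂ (H →L[ℂ] H) := W.commutant.toStarSubalgebra
  have hA : IsClosed (A : Set (H →L[ℂ] H)) := by
    change IsClosed (W.commutant : Set (H →L[ℂ] H))
    rw [VonNeumannAlgebra.coe_commutant]
    exact Set.isClosed_centralizer _
  letI : CStarAlgebra A := StarSubalgebra.cstarAlgebra A (h_closed := hA)
  have hspan := CStarAlgebra.span_unitary (A := A)
  have key : ∀ x : A, (x : H →L[ℂ] H) * s = s * x := by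
    intro x
    have hx : x ∈ Submodule.span ℂ (unitary A : Set A) := by rw [hspan]; trivial
    induction hx using Submodule.span_induction with
    | mem x hx =>
      refine h _ ?_ ?_
      · obtain ⟨h1, h2⟩ := Unitary.mem_iff.1 hx
        exact Unitary.mem_iff.2 ⟨congrArg Subtype.val h1, congrArg Subtype.val h2⟩
      · intro w hw
        exact ((VonNeumannAlgebra.mem_commutant_iff.1 x.2) w hw).symm
    | zero => simp
    | add x y _ _ hx hy => 
      change ((x : H →L[ℂ] H) + y) * s = s * (x + y)
      rw [add_mul, mul_add, hx, hy]
    | smul c x _ hx => 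
      change (c • (x : H →L[ℂ] H)) * s = s * (c • (x : H →L[ℂ] H))
      rw [smul_mul_assoc, mul_smul_comm, hx]
  exact key ⟨g, hg⟩


/-- Let `W` be a finite von Neumann algebra on a Hilbert space `H` (every isometry in `W` is a
unitary), and let `u` be a closed densely defined operator affiliated to `W` (it commutes with
every unitary in the commutant of `W`).  Then the operators `s = (1 + uu*)⁻¹` and
`a = (1 + uu*)⁻¹ u` are bounded operators lying in `W`, `s` is a non-zero-divisor in `W`, and
`u = s⁻¹ a`, i.e. `dom u = {x | a x ∈ s H}` and `s (u x) = a x` on `dom u`.  Here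
`s = (1 + uu*)⁻¹` means `s h ∈ dom u*`, `u* (s h) ∈ dom u` and `s h + u (u* (s h)) = h` for
every `h ∈ H`. -/
theorem exists_bounded_fraction_of_affiliated
    {H : Type*} [NormedAddCommGroup H] [InnerProductSpace ℂ H] [CompleteSpace H]
    (W : VonNeumannAlgebra H)
    (hfin : ∀ v ∈ W, star v * v = 1 → v * star v = 1)
    (u : H →ₗ.[ℂ] H) (hdense : Dense (u.domain : Set H)) (hclosed : u.IsClosed)
    (haff : ∀ T : H →L[ℂ] H, T ∈ unitary (H →L[ℂ] H) → (∀ w ∈ W, T * w = w * T) →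
      (∀ x : H, x ∈ u.domain ↔ T x ∈ u.domain) ∧
        ∀ (x : H) (hx : x ∈ u.domain) (hTx : T x ∈ u.domain),
          u ⟨T x, hTx⟩ = T (u ⟨x, hx⟩)) :
    ∃ s a : H →L[ℂ] H, s ∈ W ∧ a ∈ W ∧
      (∀ w ∈ W, w ≠ 0 → s * w ≠ 0 ∧ w * s ≠ 0) ∧
      (∀ h : H, ∃ (hm : s h ∈ (LinearPMap.adjoint u).domain)
        (hm2 : (LinearPMap.adjoint u) ⟨s h, hm⟩ ∈ u.domain),
          s h + u ⟨(LinearPMap.adjoint u) ⟨s h, hm⟩, hm2⟩ = h) ∧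
      (∀ (x : H) (hx : x ∈ u.domain), a x = s (u ⟨x, hx⟩)) ∧
      (∀ x : H, x ∈ u.domain ↔ a x ∈ Set.range s) := by

  obtain ⟨P, Q, hPQ⟩ := aux_proj u hclosed
  let B : H →L[ℂ] H := P ∘L ContinuousLinearMap.inr ℂ H H
  let s : H →L[ℂ] H := ContinuousLinearMap.id ℂ H - Q ∘L ContinuousLinearMap.inr ℂ H H
  have hB : ∀ h, B h ∈ u.domain := fun h => (hPQ (0, h)).1
  have hsB : ∀ h, s h + u ⟨B h, hB h⟩ = h := fun h => by
    obtain ⟨hp, h1, h2⟩ := hPQ (0, h)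
    change (h - Q (0, h)) + u ⟨P (0, h), hp⟩ = h
    rw [h1]; abel
  have hadj : ∀ h (w : u.domain), ⟪B h, (w : H)⟫_ℂ = ⟪s h, u w⟫_ℂ := fun h w => by
    obtain ⟨hp, h1, h2⟩ := hPQ (0, h)
    have := h2 w
    change ⟪P (0, h), (w : H)⟫_ℂ = ⟪h - Q (0, h), u w⟫_ℂ
    simp only [zero_sub, inner_neg_left] at this
    linear_combination -this
  -- pairing formula
  have hpair : ∀ q r : H, (∀ w : u.domain, ⟪r, (w : H)⟫_ℂ = ⟪q, u w⟫_ℂ) → ∀ h,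
      ⟪q, h⟫_ℂ = ⟪q, s h⟫_ℂ + ⟪r, B h⟫_ℂ := fun q r hqr h => by
    conv_lhs => rw [← hsB h]
    rw [inner_add_right, ← hqr ⟨B h, hB h⟩]
  have hsa : ∀ h k, ⟪s h, k⟫_ℂ = ⟪h, s k⟫_ℂ := fun h k => by
    rw [hpair (s h) (B h) (hadj h) k, ← inner_conj_symm h (s k),
      hpair (s k) (B k) (hadj k) h, map_add, inner_conj_symm, inner_conj_symm]
  have hinj : ∀ h, s h = 0 → h = 0 := fun h hh => by
    have h1 := hpair (s h) (B h) (hadj h) h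
    rw [hh] at h1
    simp only [inner_zero_left, zero_add] at h1
    have h2 : B h = 0 := inner_self_eq_zero.1 h1.symm
    have h3 := hsB h
    have h4 : (⟨B h, hB h⟩ : u.domain) = 0 := Subtype.ext h2
    rw [h4, hh, u.map_zero, add_zero] at h3
    exact h3.symm
  -- uniqueness
  have huniq : ∀ y x : H, (∀ w : u.domain, ⟪x, (w : H)⟫_ℂ = ⟪y, u w⟫_ℂ) → ∀ hx : x ∈ u.domain,
      ∀ h, y + u ⟨x, hx⟩ = h → y = s h ∧ x = B h := fun y x hxy hx h hh => by
    have e1 : ∀ w : u.domain, ⟪x - B h, (w : H)⟫_ℂ = ⟪y - s h, u w⟫_ℂ := fun w => by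
      rw [inner_sub_left, inner_sub_left, hxy, hadj]
    have e2 : (y - s h) + u (⟨x, hx⟩ - ⟨B h, hB h⟩) = 0 := by
      rw [u.map_sub]
      have := hsB h
      rw [sub_add_sub_comm, hh, this, sub_self]
    have e3 := e1 (⟨x, hx⟩ - ⟨B h, hB h⟩)
    rw [eq_neg_of_add_eq_zero_right e2, inner_neg_right] at e3
    have e4 : ⟪x - B h, x - B h⟫_ℂ + ⟪y - s h, y - s h⟫_ℂ = 0 := by
      have : ⟪x - B h, x - B h⟫_ℂ = -⟪y - s h, y - s h⟫_ℂ := e3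
      rw [this]; ring
    rw [inner_self_eq_norm_sq_to_K, inner_self_eq_norm_sq_to_K] at e4
    have e5 : ‖x - B h‖ ^ 2 + ‖y - s h‖ ^ 2 = 0 := by
      apply Complex.ofReal_injective
      rw [Complex.ofReal_add, Complex.ofReal_pow, Complex.ofReal_pow, Complex.ofReal_zero]
      exact e4
    have e6 : ‖x - B h‖ = 0 := by nlinarith [sq_nonneg ‖x - B h‖, sq_nonneg ‖y - s h‖]
    have e7 : ‖y - s h‖ = 0 := by nlinarith [sq_nonneg ‖x - B h‖, sq_nonneg ‖y - s h‖]
    exact ⟨sub_eq_zero.1 (norm_eq_zero.1 e7), sub_eq_zero.1 (norm_eq_zero.1 e6)⟩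
  have hcomm : ∀ T : H →L[ℂ] H, T ∈ unitary (H →L[ℂ] H) → (∀ w ∈ W, T * w = w * T) →
      ∀ h, T (s h) = s (T h) ∧ T (B h) = B (T h) := fun T hT hTW h => by
    obtain ⟨d1, d2⟩ := haff T hT hTW
    obtain ⟨t1, t2⟩ := Unitary.mem_iff.1 hT
    have hTs : ∀ x, T (star T x) = x := fun x => congrArg (fun S : H →L[ℂ] H => S x) t2
    have hmv : ∀ x y, ⟪T x, y⟫_ℂ = ⟪x, star T y⟫_ℂ := fun x y =>
      (ContinuousLinearMap.adjoint_inner_right T x y).symm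
    have hTB : T (B h) ∈ u.domain := (d1 _).1 (hB h)
    refine huniq _ _ (fun w => ?_) hTB (T h) ?_
    · have hw : star T (w : H) ∈ u.domain := (d1 _).2 (by rw [hTs]; exact w.2)
      have hw' : T (star T (w : H)) ∈ u.domain := by rw [hTs]; exact w.2
      have h3 := d2 _ hw hw'
      have h4 : (⟨T (star T (w : H)), hw'⟩ : u.domain) = w := Subtype.ext (hTs _)
      rw [h4] at h3
      have h5 : ∀ x, star T (T x) = x := fun x => congrArg (fun S : H →L[ℂ] H => S x) t1
      rw [hmv, hmv, h3, h5]
      exact hadj h ⟨_, hw⟩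
    · rw [d2 _ (hB h) hTB, ← map_add, hsB]
  have hsW : s ∈ W := aux_mem W s fun T h1 h2 =>
    ContinuousLinearMap.ext fun h => (hcomm T h1 h2 h).1
  have hBW : B ∈ W := aux_mem W B fun T h1 h2 =>
    ContinuousLinearMap.ext fun h => (hcomm T h1 h2 h).2
  have ha : ∀ x h, ⟪(star B) x, h⟫_ℂ = ⟪x, B h⟫_ℂ := fun x h =>
    ContinuousLinearMap.adjoint_inner_left B h x
  have hax : ∀ (x : H) (hx : x ∈ u.domain), (star B) x = s (u ⟨x, hx⟩) := fun x hx => by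
    refine ext_inner_right ℂ fun h => ?_
    rw [ha, hsa, ← inner_conj_symm, hadj h ⟨x, hx⟩, inner_conj_symm]
  refine ⟨s, star B, hsW, star_mem hBW, ?_, ?_, hax, ?_⟩
  · intro w _ hw0
    constructor
    · intro h0
      apply hw0
      ext x
      exact hinj _ (congrArg (fun S : H →L[ℂ] H => S x) h0)
    · intro h0
      apply hw0
      have h1 : ∀ x, (star w) x = 0 := fun x => by
        apply hinj
        refine ext_inner_right ℂ fun h => ?_
        rw [hsa, inner_zero_left]
        have : w (s h) = 0 := congrArg (fun S : H →L[ℂ] H => S h) h0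
        have h2 : ⟪(star w) x, s h⟫_ℂ = ⟪x, w (s h)⟫_ℂ :=
          ContinuousLinearMap.adjoint_inner_left w (s h) x
        rw [h2, this, inner_zero_right]
      have h2 : star w = 0 := ContinuousLinearMap.ext h1
      exact star_eq_zero.1 h2
  · intro h
    have hm : s h ∈ (LinearPMap.adjoint u).domain :=
      LinearPMap.mem_adjoint_domain_of_exists _ ⟨B h, hadj h⟩
    have he : (LinearPMap.adjoint u) ⟨s h, hm⟩ = B h :=
      LinearPMap.adjoint_apply_eq hdense ⟨s h, hm⟩ (hadj h)
    have hm2 : (LinearPMap.adjoint u) ⟨s h, hm⟩ ∈ u.domain := he ▸ hB h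
    refine ⟨hm, hm2, ?_⟩
    have : (⟨(LinearPMap.adjoint u) ⟨s h, hm⟩, hm2⟩ : u.domain) = ⟨B h, hB h⟩ := Subtype.ext he
    rw [this, hsB]
  · intro x
    refine ⟨fun hx => ⟨_, (hax x hx).symm⟩, ?_⟩
    rintro ⟨y, hy⟩
    obtain ⟨hp, h1, h2⟩ := hPQ (x, y)
    have hr : ∀ w : u.domain, ⟪-(x - P (x, y)), (w : H)⟫_ℂ = ⟪y - Q (x, y), u w⟫_ℂ := fun w => by
      have := h2 w
      simp only at this
      rw [inner_neg_left]
      linear_combination -this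
    have hq : y - Q (x, y) = 0 := by
      refine ext_inner_right ℂ fun h => ?_
      rw [hpair _ _ hr h, inner_zero_left, inner_neg_left, inner_sub_left, inner_sub_left,
        ← hsa y h, hy, ha, ← h1, ← hsa (u _) h, ← hax _ hp, ha]
      ring
    have hd : -(x - P (x, y)) = 0 := by
      refine hdense.eq_zero_of_inner_left ℂ fun w hw => ?_
      rw [hr ⟨w, hw⟩, hq, inner_zero_left]
    have : x = P (x, y) := sub_eq_zero.1 (neg_eq_zero.1 hd)
    rw [this]; exact hp
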